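/- arXiv:1503.04285 — 2 statements merged into one kernel-verified Lean document; each statement's English description precedes it below -/
import Mathlib

section
/- Fix q ∈ (0,1) and an integer k ≥ 0. The function ν ↦ Γ_{q²}(ν+1)/Γ_{q²}(ν+k+2) is log-convex on (0,∞); equivalently, ν ↦ log Γ_{q²}(ν+1) − log Γ_{q²}(ν+k+2) is convex on (0,∞). -/
open Real

/-- The `q`-gamma function with base `p ∈ (0,1)`:
`Γ_p(x) = (1-p)^{1-x} ∏_{n=0}^∞ (1-p^{n+1})/(1-p^{n+x})`. -/
noncomputable def qGamma (p x : ℝ) : ℝ :=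
  (1 - p) ^ (1 - x) * ∏' n : ℕ, (1 - p ^ (n + 1)) / (1 - p ^ ((n : ℝ) + x))

/-- `b_k(ν; q²)` from the series expansion of the `q`-Dunkl kernel:
`b_{2k}(ν;q²) = (1+q)^k Γ_{q²}(k+1) Γ_{q²}(ν+k+1)/Γ_{q²}(ν+1)` and
`b_{2k+1}(ν;q²) = (1+q)^{2k+1} Γ_{q²}(k+1) Γ_{q²}(ν+k+2)/Γ_{q²}(ν+1)`. -/
noncomputable def qDunklB (q : ℝ) (n : ℕ) (ν : ℝ) : ℝ :=
  if Even n then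
    (1 + q) ^ (n / 2) * qGamma (q ^ 2) ((n / 2 : ℕ) + 1) *
      qGamma (q ^ 2) (ν + (n / 2 : ℕ) + 1) / qGamma (q ^ 2) (ν + 1)
  else
    (1 + q) ^ n * qGamma (q ^ 2) ((n / 2 : ℕ) + 1) *
      qGamma (q ^ 2) (ν + (n / 2 : ℕ) + 2) / qGamma (q ^ 2) (ν + 1)

/-- The `q`-Dunkl kernel `E_ν(z; q²) = Σ_{k=0}^∞ z^k / b_k(ν; q²)`. -/
noncomputable def qDunklE (q ν z : ℝ) : ℝ :=
  ∑' k : ℕ, z ^ k / qDunklB q k ν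

/-- The infinite `q`-shifted factorial `(a; p)_∞ = ∏_{k=0}^∞ (1 - a p^k)`. -/
noncomputable def qPochInf (a p : ℝ) : ℝ :=
  ∏' k : ℕ, (1 - a * p ^ k)

/-- The weight `W_ν(x; q²) = (x²q²; q²)_∞ / (x²q^{2ν+1}; q²)_∞`. -/
noncomputable def qW (q ν x : ℝ) : ℝ :=
  qPochInf (x ^ 2 * q ^ 2) (q ^ 2) / qPochInf (x ^ 2 * q ^ (2 * ν + 1)) (q ^ 2)

/-- The `q`-exponential `E(q, z) = ∏_{k=0}^∞ (1 + z q^k)`. -/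
noncomputable def qExpBig (q z : ℝ) : ℝ :=
  ∏' k : ℕ, (1 + z * q ^ k)

/-- The `q`-Jackson integral over `[-1,1]`:
`∫_{-1}^1 f(t) d_q t = (1-q) Σ_{n=0}^∞ q^n (f(q^n) + f(-q^n))`. -/
noncomputable def jacksonSym (q : ℝ) (f : ℝ → ℝ) : ℝ :=
  (1 - q) * ∑' n : ℕ, q ^ n * (f (q ^ n) + f (-(q ^ n)))

/-- The normalized `q`-Dunkl kernel
`Ẽ_ν(x; q²) = ∫_{-1}^1 W_ν(t;q²)(1+t) E(q,(1-q)tx) d_q t`. -/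
noncomputable def qDunklEt (q ν x : ℝ) : ℝ :=
  jacksonSym q (fun t => qW q ν t * (1 + t) * qExpBig q ((1 - q) * t * x))

lemma qg_one_sub_pos {p x : ℝ} (h0 : 0 < p) (h1 : p < 1) (hx : 0 < x) : 0 < 1 - p ^ x := by
  have := Real.rpow_lt_one h0.le h1 hx
  linarith

lemma qg_factor_pos {p x : ℝ} (h0 : 0 < p) (h1 : p < 1) (hx : 0 < x) (n : ℕ) :
    0 < (1 - p ^ (n + 1)) / (1 - p ^ ((n : ℝ) + x)) := by
  apply div_pos
  · have := pow_lt_one₀ h0.le h1 (Nat.succ_ne_zero n)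
    simp only [Nat.succ_eq_add_one] at this
    linarith
  · exact qg_one_sub_pos h0 h1 (by positivity)

lemma qg_summable {p x : ℝ} (h0 : 0 < p) (h1 : p < 1) (hx : 0 < x) :
    Summable fun n : ℕ => Real.log ((1 - p ^ (n + 1)) / (1 - p ^ ((n : ℝ) + x))) := by
  have hs : Summable fun n : ℕ => (p ^ x - p) * p ^ n / (1 - p ^ ((n : ℝ) + x)) := by
    have hg : Summable fun n : ℕ => (|p ^ x - p| / (1 - p ^ x)) * p ^ n :=
      (summable_geometric_of_lt_one h0.le h1).mul_left _
    refine Summable.of_norm_bounded hg ?_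
    intro n
    have hd := qg_one_sub_pos h0 h1 hx
    have hn : 0 < 1 - p ^ ((n : ℝ) + x) := qg_one_sub_pos h0 h1 (by positivity)
    have hle : 1 - p ^ x ≤ 1 - p ^ ((n : ℝ) + x) := by
      have := Real.rpow_le_rpow_of_exponent_ge h0 h1.le
        (show x ≤ (n : ℝ) + x by have := Nat.cast_nonneg (α := ℝ) n; linarith)
      linarith
    rw [Real.norm_eq_abs, abs_div, abs_mul, abs_of_pos hn, abs_of_pos (pow_pos h0 n),
      div_mul_eq_mul_div]
    gcongr
  have := Real.summable_log_one_add_of_summable hs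
  refine this.congr ?_
  intro n
  have hn : 0 < 1 - p ^ ((n : ℝ) + x) := qg_one_sub_pos h0 h1 (by positivity)
  congr 1
  have e : p ^ ((n : ℝ) + x) = p ^ n * p ^ x := by
    rw [Real.rpow_add h0, Real.rpow_natCast]
  rw [e] at hn ⊢
  rw [eq_div_iff hn.ne', add_mul, div_mul_cancel₀ _ hn.ne']
  ring

lemma qGamma_pos' {p x : ℝ} (h0 : 0 < p) (h1 : p < 1) (hx : 0 < x) : 0 < qGamma p x := by
  unfold qGamma
  rw [← Real.rexp_tsum_eq_tprod (qg_factor_pos h0 h1 hx) (qg_summable h0 h1 hx)]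
  have : 0 < 1 - p := by linarith
  positivity

lemma qg_prod {p x : ℝ} (h0 : 0 < p) (h1 : p < 1) (hx : 0 < x) (N : ℕ) :
    ∏ n ∈ Finset.range N, (1 - p ^ (n + 1)) / (1 - p ^ ((n : ℝ) + (x + 1)))
      = (∏ n ∈ Finset.range N, (1 - p ^ (n + 1)) / (1 - p ^ ((n : ℝ) + x)))
        * ((1 - p ^ x) / (1 - p ^ ((N : ℝ) + x))) := by
  induction N with
  | zero =>
    have := qg_one_sub_pos h0 h1 hx
    simp [this.ne']
  | succ N ih =>
    rw [Finset.prod_range_succ, Finset.prod_range_succ, ih]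
    have a := qg_one_sub_pos h0 h1 (show 0 < (N : ℝ) + x by positivity)
    have b := qg_one_sub_pos h0 h1 (show 0 < (N : ℝ) + (x + 1) by positivity)
    have e : ((N + 1 : ℕ) : ℝ) + x = (N : ℝ) + (x + 1) := by push_cast; ring
    rw [e]
    field_simp

lemma qGamma_succ' {p x : ℝ} (h0 : 0 < p) (h1 : p < 1) (hx : 0 < x) :
    qGamma p (x + 1) = qGamma p x * ((1 - p ^ x) / (1 - p)) := by
  have hx1 : 0 < x + 1 := by linarith
  have t1 := (Real.multipliable_of_summable_log (qg_factor_pos h0 h1 hx1)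
    (qg_summable h0 h1 hx1)).hasProd.tendsto_prod_nat
  have t0 := (Real.multipliable_of_summable_log (qg_factor_pos h0 h1 hx)
    (qg_summable h0 h1 hx)).hasProd.tendsto_prod_nat
  have tp : Filter.Tendsto (fun N : ℕ => (1 - p ^ x) / (1 - p ^ ((N : ℝ) + x))) Filter.atTop
      (nhds (1 - p ^ x)) := by
    have h : Filter.Tendsto (fun N : ℕ => (1 - p ^ x) / (1 - p ^ N * p ^ x)) Filter.atTop
      (nhds ((1 - p ^ x) / (1 - 0 * p ^ x))) :=
      Filter.Tendsto.div tendsto_const_nhds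
        (tendsto_const_nhds.sub ((tendsto_pow_atTop_nhds_zero_of_lt_one h0.le h1).mul_const _))
        (by simp)
    simpa [Real.rpow_add h0, Real.rpow_natCast] using h
  have t2 := t0.mul tp
  have e := tendsto_nhds_unique (t1.congr (qg_prod h0 h1 hx)) t2
  unfold qGamma
  rw [e]
  have hp : 0 < 1 - p := by linarith
  have e2 : (1 - p) ^ (1 - (x + 1)) = (1 - p) ^ (1 - x) / (1 - p) := by
    rw [show 1 - (x + 1) = (1 - x) - 1 by ring, Real.rpow_sub_one hp.ne']
  rw [e2]
  field_simp

lemma qg_convex {p c : ℝ} (h0 : 0 < p) (h1 : p < 1) (hc : 0 < c) :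
    ConvexOn ℝ (Set.Ioi (0 : ℝ)) (fun ν : ℝ => - Real.log (1 - p ^ (ν + c))) := by
  refine ⟨convex_Ioi 0, ?_⟩
  intro x hx y hy a b ha hb hab
  have hx : 0 < x := hx
  have hy : 0 < y := hy
  have px := qg_one_sub_pos h0 h1 (show 0 < x + c by positivity)
  have py := qg_one_sub_pos h0 h1 (show 0 < y + c by positivity)
  have hl := strictConcaveOn_log_Ioi.concaveOn.2 (Set.mem_Ioi.2 px) (Set.mem_Ioi.2 py) ha hb hab
  have he := convexOn_exp.2 (Set.mem_univ (Real.log p * (x + c)))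
    (Set.mem_univ (Real.log p * (y + c))) ha hb hab
  simp only [smul_eq_mul] at *
  have e1 : a * (Real.log p * (x + c)) + b * (Real.log p * (y + c))
      = Real.log p * (a * x + b * y + c) := by
    linear_combination (Real.log p * c) * hab
  rw [e1, ← Real.rpow_def_of_pos h0, ← Real.rpow_def_of_pos h0, ← Real.rpow_def_of_pos h0] at he
  have hpos : 0 < a * (1 - p ^ (x + c)) + b * (1 - p ^ (y + c)) := by
    rcases ha.eq_or_lt with h | h
    · subst h
      have : b = 1 := by linarith
      subst this
      linarith
    · have := mul_pos h px
      have := mul_nonneg hb py.le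
      linarith
  have := Real.log_le_log hpos
    (show a * (1 - p ^ (x + c)) + b * (1 - p ^ (y + c)) ≤ 1 - p ^ (a * x + b * y + c) by
      linarith)
  linarith

lemma qg_ratio {p : ℝ} (h0 : 0 < p) (h1 : p < 1) (m : ℕ) :
    ConvexOn ℝ (Set.Ioi (0 : ℝ)) (fun ν : ℝ =>
      Real.log (qGamma p (ν + 1) / qGamma p (ν + (m + 1)))) := by
  induction m with
  | zero =>
    refine (convexOn_const (0 : ℝ) (convex_Ioi 0)).congr ?_
    intro ν hν
    have hν : 0 < ν := hν
    have := qGamma_pos' h0 h1 (show 0 < ν + 1 by positivity)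
    simp [div_self this.ne']
  | succ m ih =>
    refine ((ih.add (qg_convex h0 h1 (show (0 : ℝ) < m + 1 by positivity))).add_const
      (Real.log (1 - p))).congr ?_
    intro ν hν
    have hν : 0 < ν := hν
    have a := qGamma_pos' h0 h1 (show 0 < ν + 1 by positivity)
    have hm : 0 < ν + ((m : ℝ) + 1) := by positivity
    have b := qGamma_pos' h0 h1 hm
    have c := qg_one_sub_pos h0 h1 hm
    have d : 0 < 1 - p := by linarith
    have e : ν + (((m + 1 : ℕ) : ℝ) + 1) = (ν + ((m : ℝ) + 1)) + 1 := by push_cast; ring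
    simp only [Pi.add_apply]
    rw [e, qGamma_succ' h0 h1 hm, Real.log_div a.ne' b.ne', Real.log_div a.ne' (by positivity),
      Real.log_mul b.ne' (by positivity), Real.log_div c.ne' d.ne']
    ring

/-- for fixed `q ∈ (0,1)` and `k ≥ 0`, the function
`ν ↦ Γ_{q²}(ν+1)/Γ_{q²}(ν+k+2)` is log-convex on `(0,∞)`,
i.e. its logarithm is convex on `(0,∞)`. -/
theorem qGamma_ratio_logConvex' (q : ℝ) (hq : q ∈ Set.Ioo (0 : ℝ) 1) (k : ℕ) :
    ConvexOn ℝ (Set.Ioi (0 : ℝ)) (fun ν : ℝ =>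
      Real.log (qGamma (q ^ 2) (ν + 1) / qGamma (q ^ 2) (ν + k + 2))) := by
  have h0 : 0 < q ^ 2 := pow_pos hq.1 2
  have h1 : q ^ 2 < 1 := pow_lt_one₀ hq.1.le hq.2 two_ne_zero
  refine (qg_ratio h0 h1 (k + 1)).congr ?_
  intro ν _
  have e : ν + (((k + 1 : ℕ) : ℝ) + 1) = ν + k + 2 := by push_cast; ring
  simp only [e]
end

section
/- For fixed λ ≥ 0 and x ≥ 0, the function ν ↦ E_{ν+1}(λ,x) / E_ν(λ,x) is increasing on (0,∞): for all 0 < μ ≤ ν, E_{μ+1}(λ,x)/E_μ(λ,x) ≤ E_{ν+1}(λ,x)/E_ν(λ,x). -/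
open Real

/-- `b_n(ν)` from the series expansion of the Dunkl kernel:
`b_{2n}(ν) = 2^{2n} n! Γ(n+ν+1)/Γ(ν+1)` and `b_{2n+1}(ν) = 2(ν+1) b_{2n}(ν+1)`. -/
noncomputable def dunklB (n : ℕ) (ν : ℝ) : ℝ :=
  if Even n then
    2 ^ n * (Nat.factorial (n / 2)) * Real.Gamma ((n / 2 : ℕ) + ν + 1) / Real.Gamma (ν + 1)
  else
    2 * (ν + 1) *
      (2 ^ (n - 1) * (Nat.factorial (n / 2)) * Real.Gamma ((n / 2 : ℕ) + (ν + 1) + 1) /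
        Real.Gamma ((ν + 1) + 1))

/-- The Dunkl kernel `E_ν(λ, x) = Σ_{n=0}^∞ (λ x)^n / b_n(ν)`. -/
noncomputable def dunklE (ν lam x : ℝ) : ℝ :=
  ∑' n : ℕ, (lam * x) ^ n / dunklB n ν

/-- The normalized Dunkl kernel `Ẽ_ν(λ,x) = ∫_{-1}^1 e^{λxt}(1-t²)^{ν-1}(1+t) dt`. -/
noncomputable def dunklEt (ν lam x : ℝ) : ℝ :=
  ∫ t in (-1 : ℝ)..1, Real.exp (lam * x * t) * (1 - t ^ 2) ^ (ν - 1) * (1 + t)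


lemma gamma_prod (ν : ℝ) (hν : 0 < ν) (n : ℕ) :
    Real.Gamma ((n : ℝ) + ν + 1) = Real.Gamma (ν + 1) * ∏ k ∈ Finset.range n, (ν + 1 + k) := by
  induction n with
  | zero => simp
  | succ n ih =>
    have h : ((n + 1 : ℕ) : ℝ) + ν + 1 = ((n : ℝ) + ν + 1) + 1 := by push_cast; ring
    rw [h, Real.Gamma_add_one (by positivity), ih, Finset.prod_range_succ]
    ring

lemma dunklB_eq (ν : ℝ) (hν : 0 < ν) (n : ℕ) :
    dunklB n ν = 2 ^ n * (Nat.factorial (n / 2)) *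
      ∏ k ∈ Finset.range (n - n / 2), (ν + 1 + k) := by
  unfold dunklB
  split_ifs with h
  · have h2 : n - n / 2 = n / 2 := by
      obtain ⟨k, rfl⟩ := h
      omega
    have := (Real.Gamma_pos_of_pos (show 0 < ν + 1 by positivity)).ne'
    rw [gamma_prod ν hν, h2]
    field_simp
  · have ho : Odd n := Nat.not_even_iff_odd.mp h
    obtain ⟨m, rfl⟩ := ho
    have e1 : (2 * m + 1) / 2 = m := by omega
    have e2 : 2 * m + 1 - m = m + 1 := by omega
    have := (Real.Gamma_pos_of_pos (show 0 < ν + 1 + 1 by positivity)).ne'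
    rw [gamma_prod (ν + 1) (by positivity), e1, e2, Finset.prod_range_succ']
    have e3 : ∏ k ∈ Finset.range m, (ν + 1 + ((k + 1 : ℕ) : ℝ))
        = ∏ k ∈ Finset.range m, (ν + 1 + 1 + (k : ℝ)) := by
      apply Finset.prod_congr rfl
      intro k _
      push_cast; ring
    rw [e3]
    simp only [Nat.add_sub_cancel]
    field_simp
    push_cast
    ring

lemma prod_pos' (ν : ℝ) (hν : 0 < ν) (n : ℕ) : 0 < ∏ k ∈ Finset.range n, (ν + 1 + (k : ℝ)) :=
  Finset.prod_pos fun k _ => by positivity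

lemma dunklB_pos (ν : ℝ) (hν : 0 < ν) (n : ℕ) : 0 < dunklB n ν := by
  rw [dunklB_eq ν hν]
  have := prod_pos' ν hν (n - n / 2)
  positivity

lemma fact_le_prod (ν : ℝ) (hν : 0 < ν) (n : ℕ) :
    (n.factorial : ℝ) ≤ ∏ k ∈ Finset.range n, (ν + 1 + (k : ℝ)) := by
  rw [← Finset.prod_range_add_one_eq_factorial]
  push_cast
  apply Finset.prod_le_prod
  · intro k _; positivity
  · intro k _; linarith

lemma fact_le_dunklB (ν : ℝ) (hν : 0 < ν) (n : ℕ) : (n.factorial : ℝ) ≤ dunklB n ν := by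
  rw [dunklB_eq ν hν]
  have h1 : n.factorial ≤ 2 ^ n * (n / 2).factorial * (n - n / 2).factorial := by
    rw [← Nat.choose_mul_factorial_mul_factorial (Nat.div_le_self n 2)]
    gcongr
    exact Nat.choose_le_two_pow _ _
  calc (n.factorial : ℝ) ≤ 2 ^ n * (n / 2).factorial * (n - n / 2).factorial := by exact_mod_cast h1
    _ ≤ _ := by
      gcongr
      exact fact_le_prod ν hν _

lemma dunkl_summable (ν t : ℝ) (hν : 0 < ν) (ht : 0 ≤ t) :
    Summable fun n : ℕ => t ^ n / dunklB n ν := by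
  refine Summable.of_nonneg_of_le (fun n => ?_) (fun n => ?_) (Real.summable_pow_div_factorial t)
  · have := dunklB_pos ν hν n
    positivity
  · have := fact_le_dunklB ν hν n
    have h2 : (0 : ℝ) < n.factorial := by positivity
    gcongr

lemma dunklE_pos (ν l x : ℝ) (hν : 0 < ν) (ht : 0 ≤ l * x) : 0 < dunklE ν l x := by
  unfold dunklE
  refine (dunkl_summable ν _ hν ht).tsum_pos (fun n => ?_) 0 ?_
  · have := dunklB_pos ν hν n
    positivity
  · have := dunklB_pos ν hν 0
    positivity

lemma dunklB_log (a b u v : ℝ) (ha : 0 < a) (hb : 0 < b) (hu : 0 < u) (hv : 0 < v)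
    (huv : u + v = 1) (n : ℕ) :
    dunklB n a ^ u * dunklB n b ^ v ≤ dunklB n (u * a + v * b) := by
  have hc : 0 < u * a + v * b := by positivity
  rw [dunklB_eq a ha, dunklB_eq b hb, dunklB_eq _ hc]
  set C : ℝ := 2 ^ n * (Nat.factorial (n / 2)) with hC
  have hC0 : 0 < C := by positivity
  rw [Real.mul_rpow hC0.le (prod_pos' a ha _).le, Real.mul_rpow hC0.le (prod_pos' b hb _).le,
    ← Real.finsetProd_rpow _ _ (fun k _ => by positivity),
    ← Real.finsetProd_rpow _ _ (fun k _ => by positivity)]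
  have e : C ^ u * C ^ v = C := by rw [← Real.rpow_add hC0, huv, Real.rpow_one]
  rw [mul_mul_mul_comm, e, ← Finset.prod_mul_distrib]
  gcongr with k hk
  · have := Real.geom_mean_le_arith_mean2_weighted hu.le hv.le
      (show 0 ≤ a + 1 + (k : ℝ) by positivity) (show 0 ≤ b + 1 + (k : ℝ) by positivity) huv
    refine this.trans (le_of_eq ?_)
    linear_combination (1 + (k : ℝ)) * huv

lemma dunklE_log (l x a b u v : ℝ) (ht : 0 ≤ l * x) (ha : 0 < a) (hb : 0 < b)
    (hu : 0 < u) (hv : 0 < v) (huv : u + v = 1) :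
    dunklE (u * a + v * b) l x ≤ dunklE a l x ^ u * dunklE b l x ^ v := by
  have hc : 0 < u * a + v * b := by positivity
  have hA := dunklE_pos a l x ha ht
  have hB := dunklE_pos b l x hb ht
  have sA := dunkl_summable a _ ha ht
  have sB := dunkl_summable b _ hb ht
  have sC := dunkl_summable _ _ hc ht
  set A := dunklE a l x with hAd
  set B := dunklE b l x with hBd
  set t := l * x with htd
  have hK : 0 < A ^ u * B ^ v := by positivity
  have key : ∀ n : ℕ, t ^ n / dunklB n (u * a + v * b) ≤
      (A ^ u * B ^ v) * (u / A * (t ^ n / dunklB n a) + v / B * (t ^ n / dunklB n b)) := by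
    intro n
    have pa := dunklB_pos a ha n
    have pb := dunklB_pos b hb n
    have pc := dunklB_pos _ hc n
    have tn : 0 ≤ t ^ n := by positivity
    have et : (t ^ n) ^ u * (t ^ n) ^ v = t ^ n := by
      rw [← Real.rpow_add_of_nonneg tn hu.le hv.le, huv, Real.rpow_one]
    have h1 : t ^ n / dunklB n (u * a + v * b) ≤
        (t ^ n / dunklB n a) ^ u * (t ^ n / dunklB n b) ^ v := by
      rw [Real.div_rpow tn pa.le, Real.div_rpow tn pb.le, div_mul_div_comm, et]
      have := dunklB_log a b u v ha hb hu hv huv n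
      gcongr
    have h2 := Real.geom_mean_le_arith_mean2_weighted hu.le hv.le
      (show 0 ≤ (t ^ n / dunklB n a) / A by positivity)
      (show 0 ≤ (t ^ n / dunklB n b) / B by positivity) huv
    rw [Real.div_rpow (by positivity) hA.le, Real.div_rpow (by positivity) hB.le,
      div_mul_div_comm, div_le_iff₀ hK] at h2
    refine h1.trans (h2.trans (le_of_eq ?_))
    ring
  have sR := ((sA.mul_left (u / A)).add (sB.mul_left (v / B))).mul_left (A ^ u * B ^ v)
  have h := sC.tsum_le_tsum key sR
  rw [tsum_mul_left, (sA.mul_left (u / A)).tsum_add (sB.mul_left (v / B)), tsum_mul_left,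
    tsum_mul_left] at h
  change _ ≤ (A ^ u * B ^ v) * (u / A * A + v / B * B) at h
  rw [div_mul_cancel₀ _ hA.ne', div_mul_cancel₀ _ hB.ne', huv, mul_one] at h
  exact h

/-- the function `ν ↦ E_{ν+1}(λ,x)/E_ν(λ,x)` is increasing on `(0,∞)`. -/
theorem dunklE_ratio_mono (lam x : ℝ) (hlam : 0 ≤ lam) (hx : 0 ≤ x) :
    ∀ μ ν : ℝ, 0 < μ → μ ≤ ν →
      dunklE (μ + 1) lam x / dunklE μ lam x ≤ dunklE (ν + 1) lam x / dunklE ν lam x := by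
  intro μ ν hμ hμν
  have ht : 0 ≤ lam * x := mul_nonneg hlam hx
  rcases hμν.eq_or_lt with rfl | hlt
  · exact le_rfl
  have hν : 0 < ν := hμ.trans hlt
  have hA := dunklE_pos μ lam x hμ ht
  have hB := dunklE_pos (ν + 1) lam x (by positivity) ht
  have hN := dunklE_pos ν lam x hν ht
  have hM := dunklE_pos (μ + 1) lam x (by positivity) ht
  have hd : 0 < ν + 1 - μ := by linarith
  have hd1 : 0 < ν - μ := by linarith
  have hu : 0 < (ν - μ) / (ν + 1 - μ) := by positivity
  have hv : 0 < 1 / (ν + 1 - μ) := by positivity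
  have huv : (ν - μ) / (ν + 1 - μ) + 1 / (ν + 1 - μ) = 1 := by field_simp; ring
  have h1 := dunklE_log lam x μ (ν + 1) _ _ ht hμ (by positivity) hu hv huv
  have h2 := dunklE_log lam x μ (ν + 1) _ _ ht hμ (by positivity) hv hu ((add_comm _ _).trans huv)
  have e1 : (ν - μ) / (ν + 1 - μ) * μ + 1 / (ν + 1 - μ) * (ν + 1) = μ + 1 := by
    field_simp; ring
  have e2 : 1 / (ν + 1 - μ) * μ + (ν - μ) / (ν + 1 - μ) * (ν + 1) = ν := by
    field_simp; ring
  rw [e1] at h1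
  rw [e2] at h2
  rw [div_le_div_iff₀ hA hN]
  have h3 := mul_le_mul h1 h2 hN.le (by positivity)
  refine h3.trans (le_of_eq ?_)
  rw [mul_mul_mul_comm, ← Real.rpow_add hA, ← Real.rpow_add hB, huv, add_comm (1 / _), huv,
    Real.rpow_one, Real.rpow_one, mul_comm]
end
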